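/- arXiv:2402.16074 — 3 statements merged into one kernel-verified Lean document; each statement's English description precedes it below -/
import Mathlib

section
/- For every integer l ≥ 0 the Whittaker polynomial W_l satisfies the eigenfunction equation of the dual Toda Hamiltonian: in the field ℚ(q)(x) one has W_l(qx)/(1 − x^2) + W_l(q^{−1}x)/(1 − x^{−2}) = q^{−l} · W_l(x). -/
/-!
STATEMENT 0: For every integer `l ≥ 0` the Whittaker polynomial `W_l` satisfies the
eigenfunction equation of the dual Toda Hamiltonian: in `ℚ(q)(x)` one has
`W_l(qx)/(1 − x²) + W_l(q⁻¹x)/(1 − x⁻²) = q^{−l} · W_l(x)`.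

We realize `ℚ(q)(x)` as `RatFunc (RatFunc ℚ)`, with `q` the inner variable and
`x = RatFunc.X` the outer one.
-/

noncomputable section

/-- The field `ℚ(q)(x)`. -/
abbrev F : Type := RatFunc (RatFunc ℚ)

/-- The element `q` of `ℚ(q)(x)`. -/
def q : F := RatFunc.C RatFunc.X

/-- The q-Pochhammer symbol `(q²;q²)_n = ∏_{k=0}^{n-1} (1 - (q²)^k · q²)`. -/
def qPoch (n : ℕ) : F := ∏ k ∈ Finset.range n, (1 - (q ^ 2) ^ k * q ^ 2)

/-- The Gaussian binomial coefficient `binom(l,k)_{q²}`. -/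
def qBinom (l k : ℕ) : F := qPoch l / (qPoch k * qPoch (l - k))

/-- The Whittaker polynomial `W_l(z) = ∑_{k=0}^{l} binom(l,k)_{q²} z^{l-2k}`. -/
def W (l : ℕ) (z : F) : F :=
  ∑ k ∈ Finset.range (l + 1), qBinom l k * z ^ ((l : ℤ) - 2 * k)

theorem ratX_pow_ne_one {K : Type*} [Field K] (n : ℕ) (hn : 0 < n) :
    (RatFunc.X : RatFunc K) ^ n ≠ 1 := by
  intro h
  rw [← RatFunc.algebraMap_X, ← map_pow, ← map_one (algebraMap (Polynomial K) (RatFunc K))] at h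
  have h2 := RatFunc.algebraMap_injective K h
  have h3 := congrArg Polynomial.natDegree h2
  simp at h3
  omega

theorem field_final {K : Type*} [Field K] (a b c x : K) (hx : x ≠ 0) (h1 : 1 - x ^ 2 ≠ 0)
    (h : a - x ^ 2 * b - (1 - x ^ 2) * c = 0) :
    a / (1 - x ^ 2) + b / (1 - x ^ (-2 : ℤ)) = c := by
  have h2 : (1 : K) - x ^ (-2 : ℤ) = -(1 - x ^ 2) / x ^ 2 := by
    rw [zpow_neg]
    norm_cast
    field_simp
    ring
  rw [h2, div_div_eq_mul_div, div_neg, ← sub_eq_add_neg, ← sub_div, div_eq_iff h1]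
  linear_combination h

theorem q_ne_zero : q ≠ 0 := by
  unfold q
  rw [Ne, map_eq_zero]
  exact RatFunc.X_ne_zero

theorem q_factor_ne (k : ℕ) : (1 : F) - (q ^ 2) ^ k * q ^ 2 ≠ 0 := by
  intro h
  have h1 : q ^ (2 * k + 2) = 1 := by
    rw [pow_add, pow_mul]
    exact (sub_eq_zero.mp h).symm
  unfold q at h1
  rw [← map_pow, ← map_one (RatFunc.C (K := RatFunc ℚ))] at h1
  exact ratX_pow_ne_one (2 * k + 2) (by omega) (RatFunc.C_injective h1)

theorem qPoch_ne (n : ℕ) : qPoch n ≠ 0 :=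
  Finset.prod_ne_zero_iff.mpr fun k _ => q_factor_ne k

theorem qPoch_succ (n : ℕ) : qPoch (n + 1) = qPoch n * (1 - (q ^ 2) ^ n * q ^ 2) :=
  Finset.prod_range_succ _ _

theorem qBinom_step (k m : ℕ) :
    qBinom (k + m + 1) (k + 1) * (1 - (q ^ 2) ^ k * q ^ 2)
      = qBinom (k + m + 1) k * (1 - (q ^ 2) ^ m * q ^ 2) := by
  unfold qBinom
  rw [show k + m + 1 - (k + 1) = m by omega, show k + m + 1 - k = m + 1 by omega,
    qPoch_succ k, qPoch_succ m]
  have := qPoch_ne k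
  have := qPoch_ne m
  have := q_factor_ne k
  have := q_factor_ne m
  generalize (1 : F) - (q ^ 2) ^ k * q ^ 2 = a at *
  generalize (1 : F) - (q ^ 2) ^ m * q ^ 2 = b at *
  field_simp

/-- The telescoping term. -/
def telT (l : ℕ) (x : F) (k : ℕ) : F :=
  q ^ (-(l : ℤ)) * qBinom l k * (1 - (q ^ 2) ^ k) * x ^ ((l : ℤ) - 2 * k + 2)

theorem zpow_q_lin (l k m : ℕ) (h : l = k + m) :
    q ^ ((l : ℤ) - 2 * k) = q ^ (-(l : ℤ)) * (q ^ 2) ^ m := by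
  rw [← pow_mul, ← zpow_natCast, ← zpow_add₀ q_ne_zero]
  congr 1
  push_cast [h]
  ring

theorem zpow_q_lin_inv (l k : ℕ) :
    q⁻¹ ^ ((l : ℤ) - 2 * k) = q ^ (-(l : ℤ)) * (q ^ 2) ^ k := by
  rw [← pow_mul, ← zpow_natCast, ← zpow_add₀ q_ne_zero, inv_zpow, ← zpow_neg]
  congr 1
  push_cast
  ring

theorem main_term (l k m : ℕ) (h : l = k + m) (x : F) (hx : x ≠ 0) :
    qBinom l k * (q * x) ^ ((l : ℤ) - 2 * k)
      - x ^ 2 * (qBinom l k * (q⁻¹ * x) ^ ((l : ℤ) - 2 * k))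
      - q ^ (-(l : ℤ)) * (1 - x ^ 2) * (qBinom l k * x ^ ((l : ℤ) - 2 * k))
    = telT l x k - q ^ (-(l : ℤ)) * (qBinom l k * (1 - (q ^ 2) ^ m)) * x ^ ((l : ℤ) - 2 * k) := by
  unfold telT
  rw [mul_zpow, mul_zpow, zpow_q_lin l k m h, zpow_q_lin_inv, zpow_add₀ hx]
  norm_cast
  ring

theorem main_sum (l : ℕ) (x : F) (hx : x ≠ 0) :
    W l (q * x) - x ^ 2 * W l (q⁻¹ * x) - q ^ (-(l : ℤ)) * (1 - x ^ 2) * W l x = 0 := by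
  unfold W
  rw [Finset.mul_sum, Finset.mul_sum, ← Finset.sum_sub_distrib, ← Finset.sum_sub_distrib,
    Finset.sum_range_succ, main_term l l 0 (by omega) x hx]
  have : ∀ k ∈ Finset.range l, qBinom l k * (q * x) ^ ((l : ℤ) - 2 * k)
      - x ^ 2 * (qBinom l k * (q⁻¹ * x) ^ ((l : ℤ) - 2 * k))
      - q ^ (-(l : ℤ)) * (1 - x ^ 2) * (qBinom l k * x ^ ((l : ℤ) - 2 * k))
      = telT l x k - telT l x (k + 1) := by
    intro k hk
    obtain ⟨m, rfl⟩ : ∃ m, l = k + m + 1 :=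
      ⟨l - k - 1, by have := Finset.mem_range.mp hk; omega⟩
    rw [main_term _ k (m + 1) (by omega) x hx, pow_succ, ← qBinom_step]
    congr 1
    unfold telT
    rw [pow_succ (q ^ 2) k]
    rw [show ((k + m + 1 : ℕ) : ℤ) - 2 * ((k + 1 : ℕ) : ℤ) + 2
      = ((k + m + 1 : ℕ) : ℤ) - 2 * (k : ℤ) by push_cast; ring]
    ring
  rw [Finset.sum_congr rfl this, Finset.sum_range_sub']
  simp [telT]

/-- The dual Toda eigenfunction equation `Ȟ₀ W_l = q^{-l} W_l`. -/
theorem whittaker_dual_toda_eigenfunction (l : ℕ) :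
    W l (q * RatFunc.X) / (1 - RatFunc.X ^ 2)
      + W l (q⁻¹ * RatFunc.X) / (1 - RatFunc.X ^ (-2 : ℤ))
      = q ^ (-(l : ℤ)) * W l RatFunc.X := by
  have hx : (RatFunc.X : F) ≠ 0 := RatFunc.X_ne_zero
  have h := main_sum l RatFunc.X hx
  have h1 : (1 : F) - RatFunc.X ^ 2 ≠ 0 :=
    fun h => ratX_pow_ne_one 2 (by norm_num) (sub_eq_zero.mp h).symm
  refine field_final _ _ _ _ hx h1 ?_
  linear_combination h

end
end

section
/- Work over ℚ(s) with q = s^2, and for n ∈ ℤ let Ȟ_n be the operator on rational functions of x defined by (Ȟ_n f)(x) = s^n [ (x^n/(1−x^2)) f(s^2 x) + (x^{−n}/(1−x^{−2})) f(s^{−2} x) ], and let L be multiplication by x + x^{−1}. Then for every n ∈ ℤ and every rational function f one has s·Ȟ_n(L f) − s^{−1}·L·Ȟ_n(f) = (s^2 − s^{−2})·Ȟ_{n+1}(f) and s^{−1}·Ȟ_n(L f) − s·L·Ȟ_n(f) = (s^{−2} − s^{2})·Ȟ_{n−1}(f). -/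
/-!
STATEMENT 2: Work over `ℚ(s)` with `q = s²`. For `n ∈ ℤ` let `Ȟ_n` be the operator on
rational functions of `x` defined by
`(Ȟ_n f)(x) = s^n [ (x^n/(1−x²)) f(s²x) + (x^{−n}/(1−x^{−2})) f(s^{−2}x) ]`,
and let `L` be multiplication by `x + x⁻¹`.  Then for every `n ∈ ℤ` and every rational
function `f`:
`s·Ȟ_n(L f) − s⁻¹·L·Ȟ_n(f) = (s² − s⁻²)·Ȟ_{n+1}(f)` and
`s⁻¹·Ȟ_n(L f) − s·L·Ȟ_n(f) = (s⁻² − s²)·Ȟ_{n−1}(f)`.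

We realize `ℚ(s)(x)` as `RatFunc (RatFunc ℚ)` with `s` the inner variable and
`x = RatFunc.X` the outer variable; rational functions of `x` are represented as
functions `F → F`, and the operator identities are stated at the generic point
`x = RatFunc.X` (which is equivalent to the identity of rational functions).
-/

noncomputable section

/-- The element `s` (so that `q = s²`). -/
def s : F := RatFunc.C RatFunc.X

/-- The dual Toda Hamiltonian
`(Ȟ_n f)(x) = s^n [ (x^n/(1−x²)) f(s²x) + (x^{−n}/(1−x^{−2})) f(s^{−2}x) ]`. -/
def Hck (n : ℤ) (f : F → F) : F → F := fun x =>
  s ^ n * (x ^ n / (1 - x ^ 2) * f (s ^ 2 * x)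
    + x ^ (-n) / (1 - x ^ (-2 : ℤ)) * f (s ^ (-2 : ℤ) * x))

/-- Multiplication by `x + x⁻¹`. -/
def L (f : F → F) : F → F := fun x => (x + x⁻¹) * f x

theorem s_ne_zero : s ≠ 0 := by
  unfold s
  exact (map_ne_zero _).2 RatFunc.X_ne_zero

/-- The identity in an arbitrary field, with the denominators and values of `f` abstracted. -/
theorem aux_identity {K : Type*} [Field K] (s x A B P Q : K) (hs : s ≠ 0) (hx : x ≠ 0) (n : ℤ) :
    (s * (s ^ n * (x ^ n / A * ((s ^ 2 * x + (s ^ 2 * x)⁻¹) * P)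
        + x ^ (-n) / B * ((s ^ (-2 : ℤ) * x + (s ^ (-2 : ℤ) * x)⁻¹) * Q)))
      - s⁻¹ * ((x + x⁻¹) * (s ^ n * (x ^ n / A * P + x ^ (-n) / B * Q)))
      = (s ^ 2 - s ^ (-2 : ℤ)) *
        (s ^ (n + 1) * (x ^ (n + 1) / A * P + x ^ (-(n + 1)) / B * Q))) ∧
    (s⁻¹ * (s ^ n * (x ^ n / A * ((s ^ 2 * x + (s ^ 2 * x)⁻¹) * P)
        + x ^ (-n) / B * ((s ^ (-2 : ℤ) * x + (s ^ (-2 : ℤ) * x)⁻¹) * Q)))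
      - s * ((x + x⁻¹) * (s ^ n * (x ^ n / A * P + x ^ (-n) / B * Q)))
      = (s ^ (-2 : ℤ) - s ^ 2) *
        (s ^ (n - 1) * (x ^ (n - 1) / A * P + x ^ (-(n - 1)) / B * Q))) := by
  have h2 : s ^ (-2 : ℤ) = (s ^ 2)⁻¹ := by
    rw [zpow_neg]; norm_cast
  have e1 : x ^ (-(n + 1)) = x ^ (-n) * x⁻¹ := by
    rw [neg_add, zpow_add₀ hx, zpow_neg_one]
  have e2 : x ^ (-(n - 1)) = x ^ (-n) * x := by
    rw [neg_sub, sub_eq_neg_add, zpow_add_one₀ hx]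
  rw [h2, e1, e2, zpow_add_one₀ hs, zpow_add_one₀ hx, zpow_sub_one₀ hs, zpow_sub_one₀ hx]
  simp only [div_eq_mul_inv]
  generalize s ^ n = S
  generalize x ^ n = X
  generalize x ^ (-n) = Y
  generalize A⁻¹ = a
  generalize B⁻¹ = b
  constructor <;> field_simp <;> ring

/-- The commutation relations
`s·Ȟ_n(L f) − s⁻¹·L·Ȟ_n(f) = (s² − s⁻²)·Ȟ_{n+1}(f)` and
`s⁻¹·Ȟ_n(L f) − s·L·Ȟ_n(f) = (s⁻² − s²)·Ȟ_{n−1}(f)`. -/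
theorem dual_toda_commutation (n : ℤ) (f : F → F) :
    (s * Hck n (L f) RatFunc.X - s⁻¹ * L (Hck n f) RatFunc.X
      = (s ^ 2 - s ^ (-2 : ℤ)) * Hck (n + 1) f RatFunc.X) ∧
    (s⁻¹ * Hck n (L f) RatFunc.X - s * L (Hck n f) RatFunc.X
      = (s ^ (-2 : ℤ) - s ^ 2) * Hck (n - 1) f RatFunc.X) := by
  simpa only [Hck, L] using aux_identity s RatFunc.X _ _ _ _ s_ne_zero RatFunc.X_ne_zero n

end
end

section
/- The dual Toda Hamiltonians preserve symmetric Laurent polynomials: for every n ∈ ℤ and every Laurent polynomial f ∈ ℚ(q)[x, x^{−1}] with f(x) = f(x^{−1}), the rational function x^n f(qx)/(1 − x^2) + x^{−n} f(q^{−1}x)/(1 − x^{−2}) is again a Laurent polynomial in x, and it is symmetric under x ↦ x^{−1}. -/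
/-!
STATEMENT 8: The dual Toda Hamiltonians preserve symmetric Laurent polynomials: for every
`n ∈ ℤ` and every Laurent polynomial `f ∈ ℚ(q)[x,x⁻¹]` with `f(x) = f(x⁻¹)`, the rational
function `x^n f(qx)/(1 − x²) + x^{−n} f(q⁻¹x)/(1 − x^{−2})` is again a Laurent polynomial
in `x`, and it is symmetric under `x ↦ x⁻¹`.

We realize `ℚ(q)(x)` as `RatFunc (RatFunc ℚ)` (inner variable `q`, outer variable `x`);
"Laurent polynomial" means membership in the `ℚ(q)`-subalgebra generated by `x` and `x⁻¹`,
and substitution `x ↦ c` is `RatFunc.eval` with coefficients embedded via `RatFunc.C`.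
-/

noncomputable section

/-- Substitution `x ↦ c` on rational functions in `x` over `ℚ(q)`. -/
def subst (c : F) (f : F) : F := RatFunc.eval (RatFunc.C) c f

/-- The subring (as `ℚ(q)`-subalgebra) of Laurent polynomials inside `ℚ(q)(x)`. -/
def laurentSubalg : Subalgebra (RatFunc ℚ) F :=
  Algebra.adjoin (RatFunc ℚ) ({RatFunc.X, RatFunc.X⁻¹} : Set F)

/-- Substitution of a transcendental element is an algebra homomorphism. -/
def substHom (c : F) (hc : Transcendental (RatFunc ℚ) c) : F →ₐ[RatFunc ℚ] F :=
  have key : ∀ x : F, Polynomial.eval₂ (RatFunc.C) c x.denom ≠ 0 := fun x h =>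
    hc ⟨x.denom, x.denom_ne_zero, by
      rw [Polynomial.aeval_def, RatFunc.algebraMap_eq_C]; exact h⟩
  { toFun := subst c
    map_one' := RatFunc.eval_one _ _
    map_zero' := RatFunc.eval_zero _ _
    map_mul' := fun x y => RatFunc.eval_mul _ _ (key x) (key y)
    map_add' := fun x y => RatFunc.eval_add _ _ (key x) (key y)
    commutes' := fun r => by
      rw [RatFunc.algebraMap_eq_C]; exact RatFunc.eval_C _ _ }

theorem substHom_apply (c : F) (hc : Transcendental (RatFunc ℚ) c) (x : F) :
    substHom c hc x = subst c x := rfl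

theorem substHom_X (c : F) (hc : Transcendental (RatFunc ℚ) c) :
    substHom c hc RatFunc.X = c := RatFunc.eval_X _ _

theorem transX : Transcendental (RatFunc ℚ) (RatFunc.X : F) := RatFunc.transcendental_X

theorem transXinv : Transcendental (RatFunc ℚ) ((RatFunc.X : F)⁻¹) := fun h =>
  transX (by simpa using h.inv)

theorem transCX (a : RatFunc ℚ) (ha : a ≠ 0) :
    Transcendental (RatFunc ℚ) (RatFunc.C a * (RatFunc.X : F)) := fun h => by
  have ha' : (RatFunc.C a : F) ≠ 0 := by simpa using ha
  have h2 : IsAlgebraic (RatFunc ℚ) (RatFunc.C a⁻¹ : F) := by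
    rw [← RatFunc.algebraMap_eq_C]; exact isAlgebraic_algebraMap _
  have h3 := h2.mul h
  rw [← mul_assoc, map_inv₀, inv_mul_cancel₀ ha', one_mul] at h3
  exact transX h3

theorem X_mem : (RatFunc.X : F) ∈ laurentSubalg := Algebra.subset_adjoin (by simp)
theorem Xinv_mem : (RatFunc.X : F)⁻¹ ∈ laurentSubalg := Algebra.subset_adjoin (by simp)

theorem zpow_mem' (n : ℤ) : (RatFunc.X : F) ^ n ∈ laurentSubalg := by
  cases n with
  | ofNat k => simpa using pow_mem X_mem k
  | negSucc k =>
    rw [zpow_negSucc, ← inv_pow]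
    exact pow_mem Xinv_mem _

/-- A substitution sending `x` and `x⁻¹` to Laurent polynomials preserves them. -/
theorem map_mem (φ : F →ₐ[RatFunc ℚ] F) (h1 : φ RatFunc.X ∈ laurentSubalg)
    (h2 : (φ RatFunc.X)⁻¹ ∈ laurentSubalg) {f : F} (hf : f ∈ laurentSubalg) :
    φ f ∈ laurentSubalg := by
  have : laurentSubalg ≤ laurentSubalg.comap φ := by
    refine Algebra.adjoin_le ?_
    rintro x (rfl | rfl)
    · exact h1
    · change φ _ ∈ laurentSubalg
      rwa [map_inv₀]
  exact this hf

theorem ext_mem (φ ψ : F →ₐ[RatFunc ℚ] F) (h : φ RatFunc.X = ψ RatFunc.X)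
    {f : F} (hf : f ∈ laurentSubalg) : φ f = ψ f := by
  have : laurentSubalg ≤ AlgHom.equalizer φ ψ := by
    refine Algebra.adjoin_le ?_
    rintro x (rfl | rfl)
    · exact h
    · change φ _ = ψ _
      rw [map_inv₀, map_inv₀, h]
  exact this hf

theorem X_ne : (RatFunc.X : F) ≠ 0 := RatFunc.X_ne_zero

theorem one_sub_ne : (1 - (RatFunc.X : F) ^ 2) ≠ 0 := by
  intro h
  have h1 : IsAlgebraic (RatFunc ℚ) ((RatFunc.X : F) ^ 2) := by
    rw [← sub_eq_zero.mp h]; exact isAlgebraic_one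
  exact transX (h1.of_pow (by norm_num))

/-- Inversion `x ↦ x⁻¹`. -/
def tau : F →ₐ[RatFunc ℚ] F := substHom _ transXinv

theorem tau_X : tau RatFunc.X = (RatFunc.X : F)⁻¹ := substHom_X _ _

theorem tau_mem {f : F} (hf : f ∈ laurentSubalg) : tau f ∈ laurentSubalg :=
  map_mem tau (by rw [tau_X]; exact Xinv_mem) (by rw [tau_X, inv_inv]; exact X_mem) hf

theorem tau_tau {f : F} (hf : f ∈ laurentSubalg) : tau (tau f) = f :=
  ext_mem (tau.comp tau) (AlgHom.id _ _) (by simp [tau_X]) hf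

theorem antisym_div {g : F} (hg : g ∈ laurentSubalg) :
    (g - tau g) / (1 - RatFunc.X ^ 2) ∈ laurentSubalg := by
  have h0 := one_sub_ne
  have hX := X_ne
  induction hg using Algebra.adjoin_induction with
  | mem x hx =>
    rcases hx with rfl | rfl
    · have : (RatFunc.X - tau RatFunc.X) / (1 - RatFunc.X ^ 2) = -(RatFunc.X : F)⁻¹ := by
        rw [tau_X, div_eq_iff h0]; field_simp; ring
      rw [this]; exact neg_mem Xinv_mem
    · have : (RatFunc.X⁻¹ - tau RatFunc.X⁻¹) / (1 - RatFunc.X ^ 2) = (RatFunc.X : F)⁻¹ := by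
        rw [map_inv₀, tau_X, div_eq_iff h0]; field_simp
      rw [this]; exact Xinv_mem
  | algebraMap r => rw [AlgHom.commutes]; simp
  | add x y hx hy ihx ihy =>
    have := add_mem ihx ihy
    rw [← add_div] at this
    rw [map_add]
    convert this using 2
    ring
  | mul x y hx hy ihx ihy =>
    have : x * ((y - tau y) / (1 - RatFunc.X ^ 2)) + (x - tau x) / (1 - RatFunc.X ^ 2) * tau y
        ∈ laurentSubalg := add_mem (mul_mem hx ihy) (mul_mem ihx (tau_mem hy))
    rw [map_mul]
    convert this using 1
    ring

/-- The dual Toda Hamiltonians map symmetric Laurent polynomials to symmetric Laurent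
polynomials. -/
theorem dual_toda_preserves_symmetric_laurent (n : ℤ) (f : F)
    (hf : f ∈ laurentSubalg) (hsym : subst RatFunc.X⁻¹ f = f) :
    RatFunc.X ^ n * subst (q * RatFunc.X) f / (1 - RatFunc.X ^ 2)
        + RatFunc.X ^ (-n) * subst (q⁻¹ * RatFunc.X) f / (1 - RatFunc.X ^ (-2 : ℤ))
      ∈ laurentSubalg ∧
    subst RatFunc.X⁻¹
        (RatFunc.X ^ n * subst (q * RatFunc.X) f / (1 - RatFunc.X ^ 2)
          + RatFunc.X ^ (-n) * subst (q⁻¹ * RatFunc.X) f / (1 - RatFunc.X ^ (-2 : ℤ)))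
      = RatFunc.X ^ n * subst (q * RatFunc.X) f / (1 - RatFunc.X ^ 2)
          + RatFunc.X ^ (-n) * subst (q⁻¹ * RatFunc.X) f / (1 - RatFunc.X ^ (-2 : ℤ)) := by
  have hq0 : (RatFunc.X : RatFunc ℚ) ≠ 0 := RatFunc.X_ne_zero
  have hX := X_ne
  have h0 := one_sub_ne
  have hqi : q⁻¹ = RatFunc.C (RatFunc.X : RatFunc ℚ)⁻¹ := by rw [map_inv₀]; rfl
  have t2 : Transcendental (RatFunc ℚ) (q⁻¹ * RatFunc.X) := by
    rw [hqi]; exact transCX _ (inv_ne_zero hq0)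
  let σ := substHom (q * RatFunc.X) (transCX _ hq0)
  let ρ := substHom (q⁻¹ * RatFunc.X) t2
  have hσX : σ RatFunc.X = q * RatFunc.X := substHom_X _ _
  have hρX : ρ RatFunc.X = q⁻¹ * RatFunc.X := substHom_X _ _
  have htq : tau q = q := by
    have := tau.commutes (RatFunc.X : RatFunc ℚ)
    rwa [RatFunc.algebraMap_eq_C] at this
  have hCm : ∀ a : RatFunc ℚ, RatFunc.C a ∈ laurentSubalg := fun a => by
    rw [← RatFunc.algebraMap_eq_C]; exact laurentSubalg.algebraMap_mem a
  have hA : σ f ∈ laurentSubalg := by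
    refine map_mem σ ?_ ?_ hf
    · rw [hσX]; exact mul_mem (hCm _) X_mem
    · rw [hσX, mul_inv, hqi]; exact mul_mem (hCm _) Xinv_mem
  have hB : ρ f = tau (σ f) := by
    have h1 : ρ f = ρ (tau f) := by
      congr 1; exact hsym.symm
    rw [h1]
    refine ext_mem (ρ.comp tau) (tau.comp σ) ?_ hf
    simp only [AlgHom.comp_apply, tau_X, hσX, map_inv₀, hρX, map_mul, htq, mul_inv, inv_inv]
  change RatFunc.X ^ n * σ f / (1 - RatFunc.X ^ 2)
        + RatFunc.X ^ (-n) * ρ f / (1 - RatFunc.X ^ (-2 : ℤ)) ∈ laurentSubalg ∧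
    tau (RatFunc.X ^ n * σ f / (1 - RatFunc.X ^ 2)
        + RatFunc.X ^ (-n) * ρ f / (1 - RatFunc.X ^ (-2 : ℤ)))
      = RatFunc.X ^ n * σ f / (1 - RatFunc.X ^ 2)
        + RatFunc.X ^ (-n) * ρ f / (1 - RatFunc.X ^ (-2 : ℤ))
  rw [hB]
  have hz : (RatFunc.X : F) ^ (-2 : ℤ) = (RatFunc.X ^ 2)⁻¹ := by
    rw [zpow_neg]; norm_cast
  constructor
  · have hg := mul_mem X_mem (antisym_div (mul_mem (zpow_mem' (n - 1)) hA))
    convert hg using 1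
    have h3 : (1 - (RatFunc.X : F) ^ (-2 : ℤ)) = -(1 - RatFunc.X ^ 2) * (RatFunc.X ^ 2)⁻¹ := by
      rw [hz]; field_simp; ring
    rw [h3, map_mul, map_zpow₀, tau_X, zpow_neg, inv_zpow, zpow_sub_one₀ hX]
    have hXn : (RatFunc.X : F) ^ n ≠ 0 := zpow_ne_zero _ hX
    generalize (RatFunc.X : F) ^ n = Y at *
    generalize σ f = A at *
    generalize tau A = B at *
    field_simp
    ring
  · rw [map_add, map_div₀, map_div₀, map_mul, map_mul, map_sub, map_sub, map_one, map_pow,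
      map_zpow₀, map_zpow₀, map_zpow₀, tau_X, tau_tau hA, hz, add_comm]
    simp [zpow_neg, inv_zpow]

end
end
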